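/- Let R be a Henselian local ring whose residue field κ is separably closed, and let A be a smooth R-algebra (that is, A is formally smooth over R and of finite presentation) such that the ring A ⊗_R κ is nonzero. Then there exists an R-algebra homomorphism A → R; equivalently, the affine scheme Spec A has a section over Spec R. -/

import Mathlib

open scoped TensorProduct

universe u

theorem IsSepClosed.infinite (k : Type*) [Field k] [IsSepClosed k] : Infinite k := by
  by_contra h
  have : Finite k := not_infinite_iff_finite.mp h
  have : IsAlgClosed k := IsSepClosed.isAlgClosed_of_perfectField k
  exact h inferInstance

/-- A simple root of a polynomial over a separably closed field lies in that field. -/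
theorem IsSepClosed.mem_range_algebraMap_of_aeval_derivative_ne_zero
    {k K : Type*} [Field k] [IsSepClosed k] [Field K] [Algebra k K] {f : Polynomial k} {x : K}
    (hf : Polynomial.aeval x f = 0) (hf' : Polynomial.aeval x f.derivative ≠ 0) :
    x ∈ (algebraMap k K).range := by
  have hint : IsIntegral k x := by
    refine (isAlgebraic_iff_isIntegral).mp ⟨f, ?_, hf⟩
    rintro rfl
    simp at hf'
  have hirr := minpoly.irreducible hint
  refine minpoly.mem_range_of_degree_eq_one k x
    (IsSepClosed.degree_eq_one_of_irreducible k hirr ?_)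
  rw [Polynomial.separable_iff_derivative_ne_zero hirr]
  intro h
  obtain ⟨g, hg⟩ := minpoly.dvd k x hf
  apply hf'
  simp [hg, h]

/-- Over a Henselian local ring with separably closed residue field `κ`, a standard étale pair
with a point in some extension field of `κ` has a point in the ring itself. -/
theorem StandardEtalePair.exists_hasMap_of_henselianLocalRing
    {R K : Type*} [CommRing R] [HenselianLocalRing R] [IsSepClosed (IsLocalRing.ResidueField R)]
    [Field K] [Algebra (IsLocalRing.ResidueField R) K] (P : StandardEtalePair R) {x : K}
    (hx : (P.map (IsLocalRing.residue R)).HasMap x) : ∃ a : R, P.HasMap a := by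
  obtain ⟨a, rfl⟩ := IsSepClosed.mem_range_algebraMap_of_aeval_derivative_ne_zero hx.1
    hx.isUnit_derivative_f.ne_zero
  have hder := hx.isUnit_derivative_f.ne_zero
  obtain ⟨hf, hg⟩ := hx
  replace hg := hg.ne_zero
  simp only [Polynomial.aeval_algebraMap_apply, ne_eq, map_eq_zero, StandardEtalePair.map_f,
    StandardEtalePair.map_g, Polynomial.derivative_map,
    Polynomial.coe_aeval_eq_eval, Polynomial.eval_map] at hf hg hder
  have hensel := (HenselianLocalRing.TFAE R).out 0 1
  obtain ⟨b, hb, rfl⟩ := hensel.mp ‹_› P.f P.monic_f a hf hder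
  refine ⟨b, by simpa using hb, ?_⟩
  rw [Polynomial.eval₂_at_apply] at hg
  simpa using (IsLocalRing.residue_ne_zero_iff_isUnit _).mp hg

/-- If `R` is a Henselian local ring with separably closed residue field, then a standard étale
algebra `S` over a ring `T` surjecting onto `R` has an `R`-point as soon as it has a prime above
the closed point of `R`. -/
theorem Algebra.IsStandardEtale.nonempty_algHom_of_henselianLocalRing
    {R T S : Type*} [CommRing R] [HenselianLocalRing R] [IsSepClosed (IsLocalRing.ResidueField R)]
    [CommRing T] [CommRing S] [Algebra T R] [Algebra T S] [Algebra.IsStandardEtale T S]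
    (hT : Function.Surjective (algebraMap T R)) (Q : Ideal S) [Q.IsPrime]
    (hQ : (IsLocalRing.maximalIdeal R).comap (algebraMap T R) ≤ Q.comap (algebraMap T S)) :
    Nonempty (S →ₐ[T] R) := by
  obtain ⟨P⟩ := Algebra.IsStandardEtale.nonempty_standardEtalePresentation (R := T) (S := S)
  let π : T →+* IsLocalRing.ResidueField R := (IsLocalRing.residue R).comp (algebraMap T R)
  have hπ : Function.Surjective π := IsLocalRing.residue_surjective.comp hT
  let ψ : IsLocalRing.ResidueField R →+* Q.ResidueField :=
    RingHom.liftOfSurjective π hπ ⟨algebraMap T Q.ResidueField, fun t ht ↦ by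
      have : t ∈ Q.comap (algebraMap T S) := hQ (by simpa [π] using ht)
      rw [RingHom.mem_ker, IsScalarTower.algebraMap_apply T S]
      simpa using this⟩
  have hψ : ψ.comp π = algebraMap T Q.ResidueField := RingHom.liftOfRightInverse_comp ..
  algebraize [ψ]
  have hx := P.hasMap.map (IsScalarTower.toAlgHom T S Q.ResidueField)
  have hx' : ((P.P.map (algebraMap T R)).map (IsLocalRing.residue R)).HasMap
      (algebraMap S Q.ResidueField P.x) := by
    have hmap (p : Polynomial T) : Polynomial.aeval (algebraMap S Q.ResidueField P.x)
        ((p.map (algebraMap T R)).map (IsLocalRing.residue R)) =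
        Polynomial.aeval (algebraMap S Q.ResidueField P.x) p := by
      rw [Polynomial.map_map, Polynomial.aeval_def, Polynomial.eval₂_map]
      exact congrArg (fun φ ↦ Polynomial.eval₂ φ _ p) hψ
    exact ⟨(hmap _).trans hx.1, (hmap _).symm ▸ hx.2⟩
  obtain ⟨a, ha⟩ := StandardEtalePair.exists_hasMap_of_henselianLocalRing _ hx'
  have ha' : P.P.HasMap a := by simpa [StandardEtalePair.HasMap] using ha
  exact ⟨(P.P.lift a ha').comp P.equivRing.toAlgHom⟩

/-- A polynomial over a local ring with infinite residue field that is nonzero modulo the maximal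
ideal takes a unit value. -/
theorem MvPolynomial.exists_isUnit_eval_of_map_residue_ne_zero
    {R σ : Type*} [CommRing R] [IsLocalRing R] [Infinite (IsLocalRing.ResidueField R)]
    {h : MvPolynomial σ R} (hh : MvPolynomial.map (IsLocalRing.residue R) h ≠ 0) :
    ∃ c : σ → R, IsUnit (MvPolynomial.eval c h) := by
  by_contra! H
  refine hh (MvPolynomial.funext fun c ↦ ?_)
  choose d hd using fun i ↦ IsLocalRing.residue_surjective (c i)
  obtain rfl : IsLocalRing.residue R ∘ d = c := _root_.funext hd
  rw [map_zero, ← MvPolynomial.map_eval]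
  exact (IsLocalRing.residue_eq_zero_iff _).mpr (H d)

/-- If `A ⊗[R] κ ≠ 0`, then `A` has a prime lying over the maximal ideal of `R`. -/
theorem IsLocalRing.exists_isPrime_maximalIdeal_le_comap
    (R A : Type*) [CommRing R] [IsLocalRing R] [CommRing A] [Algebra R A]
    [Nontrivial (A ⊗[R] IsLocalRing.ResidueField R)] :
    ∃ q : Ideal A, q.IsPrime ∧ IsLocalRing.maximalIdeal R ≤ q.comap (algebraMap R A) := by
  obtain ⟨M, hM⟩ := Ideal.exists_maximal (A ⊗[R] IsLocalRing.ResidueField R)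
  refine ⟨M.comap (algebraMap A _), inferInstance, fun r hr ↦ ?_⟩
  rw [Ideal.mem_comap, Ideal.mem_comap, ← IsScalarTower.algebraMap_apply,
    Algebra.TensorProduct.algebraMap_apply, Algebra.TensorProduct.tmul_one_eq_one_tmul,
    IsLocalRing.ResidueField.algebraMap_eq, (IsLocalRing.residue_eq_zero_iff r).mpr hr,
    TensorProduct.tmul_zero]
  exact M.zero_mem

/-- Sections of smooth schemes over a Henselian local ring with separably closed residue
field: if `R` is Henselian local with separably closed residue field `κ` and `A` is a
smooth `R`-algebra with `A ⊗[R] κ ≠ 0`, then there is an `R`-algebra map `A → R`,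
i.e. `Spec A → Spec R` has a section. -/
theorem exists_section_of_smooth_of_henselian
    (R : Type u) [CommRing R] [HenselianLocalRing R]
    [IsSepClosed (IsLocalRing.ResidueField R)]
    (A : Type u) [CommRing A] [Algebra R A]
    [Algebra.FormallySmooth R A] [Algebra.FinitePresentation R A]
    [Nontrivial (A ⊗[R] IsLocalRing.ResidueField R)] :
    Nonempty (A →ₐ[R] R) := by
  have : Infinite (IsLocalRing.ResidueField R) := IsSepClosed.infinite _
  obtain ⟨q, hq, hmq⟩ := IsLocalRing.exists_isPrime_maximalIdeal_le_comap R A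
  obtain ⟨f, hf, n, _, _, _⟩ :=
    Algebra.IsSmoothAt.exists_isStandardEtale_mvPolynomial (R := R) (p := q)
  let T := MvPolynomial (Fin n) R
  let S := Localization.Away f
  obtain ⟨Q, hQ⟩ : (⟨q, hq⟩ : PrimeSpectrum A) ∈
      Set.range (PrimeSpectrum.comap (algebraMap A S)) := by
    rw [PrimeSpectrum.localization_away_comap_range S f]
    exact hf
  have hmQ : IsLocalRing.maximalIdeal R ≤ Q.asIdeal.comap (algebraMap R S) := by
    rw [IsScalarTower.algebraMap_eq R A S, ← Ideal.comap_comap]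
    exact hmq.trans_eq (congrArg (fun p ↦ p.asIdeal.comap (algebraMap R A)) hQ).symm
  have hopen : IsOpenMap (PrimeSpectrum.comap (algebraMap T S)) :=
    PrimeSpectrum.isOpenMap_comap_of_hasGoingDown_of_finitePresentation
  obtain ⟨_, ⟨h, rfl⟩, hhQ, hh⟩ :=
    PrimeSpectrum.isTopologicalBasis_basic_opens.exists_subset_of_mem_open
      (Set.mem_range_self Q) hopen.isOpen_range
  have hh0 : MvPolynomial.map (IsLocalRing.residue R) h ≠ 0 := by
    intro h0
    rw [← RingHom.mem_ker, MvPolynomial.ker_map, IsLocalRing.ker_residue] at h0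
    refine hhQ (Ideal.map_le_iff_le_comap.mpr ?_ h0)
    rw [IsScalarTower.algebraMap_eq R T S, ← Ideal.comap_comap] at hmQ
    exact hmQ
  obtain ⟨c, hc⟩ := MvPolynomial.exists_isUnit_eval_of_map_residue_ne_zero hh0
  let : Algebra T R := (MvPolynomial.eval c).toAlgebra
  have : IsScalarTower R T R := .of_algebraMap_eq fun r ↦ (MvPolynomial.eval_C r).symm
  obtain ⟨Q', hQ'⟩ := hh (show PrimeSpectrum.comap (algebraMap T R)
    (IsLocalRing.closedPoint R) ∈ _ from fun hmem ↦ hmem hc)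
  obtain ⟨φ⟩ := Algebra.IsStandardEtale.nonempty_algHom_of_henselianLocalRing (R := R) (T := T)
    (S := S) (fun r ↦ ⟨MvPolynomial.C r, MvPolynomial.eval_C r⟩) Q'.asIdeal
    (congrArg PrimeSpectrum.asIdeal hQ').ge
  exact ⟨(φ.restrictScalars R).comp (IsScalarTower.toAlgHom R A S)⟩
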